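/- arXiv:2405.10392 — 7 statements merged into one kernel-verified Lean document; each statement's English description precedes it below -/
import Mathlib

section
/- Let μ be a probability measure on ℝ^d with finite second moment, mean V = ∫ x dμ(x), energy 2E = ∫ |x|² dμ(x), and covariance matrix cov(μ) = ∫ (x−V)⊗(x−V) dμ(x). Let A be the Maxwellian Landau kernel (γ = 0) and set ε = tr(cov(μ)) − ‖cov(μ)‖_op, where ‖·‖_op is the operator norm. Then for every x ∈ ℝ^d and every unit vector w ∈ ℝ^d, ε ≤ ⟨w, (A∗μ)(x) w⟩ ≤ 2E + |x − V|². Moreover, ε ≥ 0, i.e. in particular (A∗μ)(x) − ε I is positive semi-definite. -/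
open MeasureTheory
open scoped RealInnerProductSpace

/-- The Landau collision kernel with parameter `γ`, acting on vectors:
`A(z)w = |z|^γ (|z|² w − ⟨z,w⟩ z)`. The Maxwellian case is `γ = 0`. -/
noncomputable def landauA (d : ℕ) (γ : ℝ) (z w : EuclideanSpace ℝ (Fin d)) :
    EuclideanSpace ℝ (Fin d) :=
  ‖z‖ ^ γ • (‖z‖ ^ 2 • w - ⟪z, w⟫ • z)

/-- For a probability measure `μ` with finite second moment, mean `V`, energy `2E`, and
covariance matrix `C`, setting `ε = tr C − ‖C‖_op`, the Maxwellian convolution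
`(A∗μ)(x)` satisfies `ε ≤ ⟨w, (A∗μ)(x) w⟩ ≤ 2E + |x−V|²` for every `x` and every unit
vector `w`; moreover `ε ≥ 0`. -/
theorem maxwellian_convolution_bounds (d : ℕ) (hd : 1 ≤ d)
    (μ : Measure (EuclideanSpace ℝ (Fin d))) [IsProbabilityMeasure μ]
    (hmom : Integrable (fun x => ‖x‖ ^ 2) μ)
    (V : EuclideanSpace ℝ (Fin d)) (hV : V = ∫ x, x ∂μ)
    (twoE : ℝ) (hE : twoE = ∫ x, ‖x‖ ^ 2 ∂μ)
    (C : Matrix (Fin d) (Fin d) ℝ)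
    (hC : ∀ i j, C i j = ∫ x, (x i - V i) * (x j - V j) ∂μ)
    (ε : ℝ) (hε : ε = Matrix.trace C - ‖Matrix.toEuclideanCLM (𝕜 := ℝ) C‖) :
    0 ≤ ε ∧
    ∀ (x w : EuclideanSpace ℝ (Fin d)), ‖w‖ = 1 →
      ε ≤ ⟪w, ∫ y, landauA d 0 (x - y) w ∂μ⟫ ∧
      ⟪w, ∫ y, landauA d 0 (x - y) w ∂μ⟫ ≤ twoE + ‖x - V‖ ^ 2 := by
  have hid2 : MemLp (fun y : EuclideanSpace ℝ (Fin d) => y) 2 μ :=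
    (memLp_two_iff_integrable_sq_norm aestronglyMeasurable_id).2 hmom
  have hc2 : ∀ c : EuclideanSpace ℝ (Fin d), MemLp (fun y : EuclideanSpace ℝ (Fin d) => y - c) 2 μ :=
    fun c => hid2.sub (memLp_const c)
  have hcs : ∀ c : EuclideanSpace ℝ (Fin d), Integrable (fun y => ‖y - c‖ ^ 2) μ := fun c =>
    (memLp_two_iff_integrable_sq_norm (hc2 c).1).1 (hc2 c)
  have hid : Integrable (fun y : EuclideanSpace ℝ (Fin d) => y) μ := hid2.integrable (by norm_num)
  have hz : Integrable (fun y : EuclideanSpace ℝ (Fin d) => y - V) μ := (hc2 V).integrable (by norm_num)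
  have hz0 : ∫ y, (y - V) ∂μ = 0 := by
    rw [integral_sub hid (integrable_const _), ← hV]; simp
  have hin : ∀ u v : EuclideanSpace ℝ (Fin d),
      Integrable (fun y => ⟪u, y - V⟫ * ⟪v, y - V⟫) μ := fun u v =>
    ((hc2 V).const_inner u).integrable_mul ((hc2 V).const_inner v)
  have hL0 : ∀ L : EuclideanSpace ℝ (Fin d), ∫ y, ⟪L, y - V⟫ ∂μ = 0 := fun L => by
    rw [integral_inner hz, hz0, inner_zero_right]
  have hco : ∀ i, MemLp (fun y : EuclideanSpace ℝ (Fin d) => y i - V i) 2 μ := fun i => by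
    have := (hc2 V).const_inner (𝕜 := ℝ) (EuclideanSpace.single i (1:ℝ))
    simpa [EuclideanSpace.inner_single_left] using this
  have hcoi : ∀ i j, Integrable (fun y : EuclideanSpace ℝ (Fin d) => (y i - V i) * (y j - V j)) μ :=
    fun i j => (hco i).integrable_mul (hco j)
  have htr : Matrix.trace C = ∫ y, ‖y - V‖ ^ 2 ∂μ := by
    simp only [Matrix.trace, Matrix.diag, hC]
    rw [← integral_finsetSum _ (fun i _ => hcoi i i)]
    congr 1; ext y
    rw [EuclideanSpace.real_norm_sq_eq]
    simp [pow_two]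
  have hquad : ∀ u v : EuclideanSpace ℝ (Fin d),
      ⟪u, Matrix.toEuclideanCLM (𝕜 := ℝ) C v⟫ = ∫ y, ⟪u, y - V⟫ * ⟪v, y - V⟫ ∂μ := by
    intro u v
    have e : ∀ y : EuclideanSpace ℝ (Fin d), ⟪u, y - V⟫ * ⟪v, y - V⟫ =
        ∑ i, ∑ j, (u i * v j) * ((y i - V i) * (y j - V j)) := by
      intro y
      simp only [PiLp.inner_apply, Finset.sum_mul_sum]
      refine Finset.sum_congr rfl fun i _ => Finset.sum_congr rfl fun j _ => ?_
      simp; ring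
    simp_rw [e]
    rw [integral_finsetSum _ (fun i _ => integrable_finsetSum _ fun j _ => (hcoi i j).const_mul _)]
    simp only [PiLp.inner_apply]
    refine Finset.sum_congr rfl fun i _ => ?_
    rw [integral_finsetSum _ (fun j _ => (hcoi i j).const_mul _)]
    simp only [integral_const_mul, ← hC]
    simp [Matrix.mulVec, dotProduct, Finset.sum_mul]
    refine Finset.sum_congr rfl fun j _ => ?_
    ring
  have htr0 : 0 ≤ Matrix.trace C := by
    rw [htr]; exact integral_nonneg fun y => by positivity
  have hop : ‖Matrix.toEuclideanCLM (𝕜 := ℝ) C‖ ≤ Matrix.trace C := by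
    refine ContinuousLinearMap.opNorm_le_bound _ htr0 fun v => ?_
    set u := Matrix.toEuclideanCLM (𝕜 := ℝ) C v with hu
    have h1 : ‖u‖ ^ 2 ≤ ‖u‖ * ‖v‖ * Matrix.trace C := by
      rw [← real_inner_self_eq_norm_sq]
      conv_lhs => rw [hu]
      rw [← hu, hquad u v, htr, ← integral_const_mul]
      refine integral_mono (hin u v) ((hcs V).const_mul _) fun y => ?_
      have h2 := abs_real_inner_le_norm u (y - V)
      have h3 := abs_real_inner_le_norm v (y - V)
      calc ⟪u, y - V⟫ * ⟪v, y - V⟫ ≤ |⟪u, y - V⟫| * |⟪v, y - V⟫| := by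
            rw [← abs_mul]; exact le_abs_self _
        _ ≤ (‖u‖ * ‖y - V‖) * (‖v‖ * ‖y - V‖) := by gcongr
        _ = _ := by ring
    rcases (norm_nonneg u).eq_or_lt with h | h
    · rw [← h]; positivity
    · nlinarith
  refine ⟨by rw [hε]; linarith, fun x w hw => ?_⟩
  have hF : Integrable (fun y => landauA d 0 (x - y) w) μ := by
    refine ((hcs x).const_mul 2).mono' ?_ (Filter.Eventually.of_forall fun y => ?_)
    · simp only [landauA, Real.rpow_zero]
      exact Continuous.aestronglyMeasurable (by fun_prop)
    · simp only [landauA, Real.rpow_zero, one_smul]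
      have h2 := abs_real_inner_le_norm (x - y) w
      refine (norm_sub_le _ _).trans ?_
      rw [norm_smul, norm_smul, hw, norm_sub_rev y x]
      rw [hw] at h2
      simp only [norm_pow, Real.norm_eq_abs, abs_norm]
      nlinarith [norm_nonneg (x - y)]
  have hval : ⟪w, ∫ y, landauA d 0 (x - y) w ∂μ⟫ = (‖x - V‖ ^ 2 - ⟪w, x - V⟫ ^ 2)
      + (Matrix.trace C - ⟪w, Matrix.toEuclideanCLM (𝕜 := ℝ) C w⟫) := by
    rw [← integral_inner hF, hquad, htr, ← integral_sub (hcs V) (hin w w)]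
    have e : ∀ y, ⟪w, landauA d 0 (x - y) w⟫ = (‖x - V‖ ^ 2 - ⟪w, x - V⟫ ^ 2)
        + ⟪(2 * ⟪w, x - V⟫) • w - (2:ℝ) • (x - V), y - V⟫
        + (‖y - V‖ ^ 2 - ⟪w, y - V⟫ * ⟪w, y - V⟫) := by
      intro y
      have hxy : x - y = (x - V) - (y - V) := by abel
      rw [landauA, hxy]
      generalize x - V = a
      generalize y - V = z
      simp only [Real.rpow_zero, one_smul, inner_sub_right, inner_sub_left, inner_smul_right,
        inner_smul_left, real_inner_self_eq_norm_sq, hw, norm_sub_sq_real, real_inner_comm w]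
      simp
      ring
    simp_rw [e]
    have i1 : ∀ (k : ℝ) (L : EuclideanSpace ℝ (Fin d)), Integrable (fun y => k + ⟪L, y - V⟫) μ :=
      fun k L => (integrable_const _).add (hz.const_inner _)
    have i2 : Integrable (fun y => ‖y - V‖ ^ 2 - ⟪w, y - V⟫ * ⟪w, y - V⟫) μ := (hcs V).sub (hin w w)
    rw [integral_add (i1 _ _) i2,
      integral_add (integrable_const _) (hz.const_inner _), hL0]
    simp
  have hcs1 : ⟪w, x - V⟫ ^ 2 ≤ ‖x - V‖ ^ 2 := by
    have := abs_real_inner_le_norm w (x - V)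
    rw [hw, one_mul] at this
    exact sq_le_sq.2 (by simpa using this)
  have hwC : ⟪w, Matrix.toEuclideanCLM (𝕜 := ℝ) C w⟫ ≤ ‖Matrix.toEuclideanCLM (𝕜 := ℝ) C‖ := by
    have h1 := real_inner_le_norm w (Matrix.toEuclideanCLM (𝕜 := ℝ) C w)
    have h2 := (Matrix.toEuclideanCLM (𝕜 := ℝ) C).le_opNorm w
    rw [hw] at h1 h2
    linarith
  have hwC0 : 0 ≤ ⟪w, Matrix.toEuclideanCLM (𝕜 := ℝ) C w⟫ := by
    rw [hquad]; exact integral_nonneg fun y => mul_self_nonneg _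
  have htrE : Matrix.trace C ≤ twoE := by
    have e : ∀ y : EuclideanSpace ℝ (Fin d), ‖y‖ ^ 2 = ‖y - V‖ ^ 2 + ⟪(2:ℝ) • V, y - V⟫ + ‖V‖ ^ 2 := by
      intro y
      have h : y = (y - V) + V := by abel
      conv_lhs => rw [h]
      rw [norm_add_sq_real, inner_smul_left, real_inner_comm V]
      simp
    have : twoE = Matrix.trace C + ‖V‖ ^ 2 := by
      rw [hE, htr]
      have i1 : ∀ (L : EuclideanSpace ℝ (Fin d)), Integrable (fun y => ‖y - V‖ ^ 2 + ⟪L, y - V⟫) μ :=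
        fun L => (hcs V).add (hz.const_inner _)
      rw [integral_congr_ae (Filter.Eventually.of_forall e), integral_add (i1 _) (integrable_const _),
        integral_add (hcs V) (hz.const_inner _), hL0]
      simp
    nlinarith [sq_nonneg ‖V‖]
  rw [hval, hε]
  constructor <;> nlinarith [sq_nonneg ⟪w, x - V⟫]
end

section
/- Let n ≥ 1, γ ∈ ℝ, A the Landau collision kernel on ℝ^d, and for each t let s_t : ℝ^d → ℝ^d. Let X_1, …, X_n : [0,∞) → ℝ^d be differentiable curves satisfying the particle ODE system X_i'(t) = −(1/n) ∑_{j=1}^n A(X_i(t) − X_j(t)) (s_t(X_i(t)) − s_t(X_j(t))) for all i and all t ≥ 0. Then the empirical momentum and energy are conserved: for all t ≥ 0, (1/n) ∑_{i=1}^n X_i(t) = (1/n) ∑_{i=1}^n X_i(0) and (1/n) ∑_{i=1}^n |X_i(t)|² = (1/n) ∑_{i=1}^n |X_i(0)|². -/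
open MeasureTheory
open scoped RealInnerProductSpace

theorem landauA_neg_aux (d : ℕ) (γ : ℝ) (z w : EuclideanSpace ℝ (Fin d)) :
    landauA d γ (-z) (-w) = - landauA d γ z w := by
  unfold landauA
  rw [norm_neg, inner_neg_neg, ← smul_neg]
  congr 1
  module

theorem inner_landauA_aux (d : ℕ) (γ : ℝ) (z w : EuclideanSpace ℝ (Fin d)) :
    ⟪z, landauA d γ z w⟫ = 0 := by
  unfold landauA
  rw [inner_smul_right, inner_sub_right, inner_smul_right, inner_smul_right,
    real_inner_self_eq_norm_sq]
  ring

theorem const_aux {E : Type*} [NormedAddCommGroup E] [NormedSpace ℝ E] (f : ℝ → E)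
    (h : ∀ t, 0 ≤ t → HasDerivAt f 0 t) (t : ℝ) (ht : 0 ≤ t) : f t = f 0 :=
  constant_of_has_deriv_right_zero (a := 0) (b := t)
    (fun x hx => (h x hx.1).continuousAt.continuousWithinAt)
    (fun x hx => (h x hx.1).hasDerivWithinAt) t ⟨ht, le_refl t⟩

/-- The particle ODE system
`Xᵢ'(t) = −(1/n) ∑ⱼ A(Xᵢ−Xⱼ)(s_t(Xᵢ)−s_t(Xⱼ))` conserves the empirical momentum
and energy: `(1/n) ∑ᵢ Xᵢ(t) = (1/n) ∑ᵢ Xᵢ(0)` and `(1/n) ∑ᵢ |Xᵢ(t)|² = (1/n) ∑ᵢ |Xᵢ(0)|²`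
for all `t ≥ 0`. -/
theorem particle_ode_conservation (d n : ℕ) (hn : 1 ≤ n) (γ : ℝ)
    (s : ℝ → EuclideanSpace ℝ (Fin d) → EuclideanSpace ℝ (Fin d))
    (X : Fin n → ℝ → EuclideanSpace ℝ (Fin d))
    (hODE : ∀ (i : Fin n) (t : ℝ), 0 ≤ t →
      HasDerivAt (X i)
        (-(1 / (n : ℝ)) •
          ∑ j, landauA d γ (X i t - X j t) (s t (X i t) - s t (X j t))) t)
    (t : ℝ) (ht : 0 ≤ t) :
    (1 / (n : ℝ)) • ∑ i, X i t = (1 / (n : ℝ)) • ∑ i, X i 0 ∧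
    (1 / (n : ℝ)) * ∑ i, ‖X i t‖ ^ 2 = (1 / (n : ℝ)) * ∑ i, ‖X i 0‖ ^ 2 := by
  have hanti : ∀ t i j, landauA d γ (X j t - X i t) (s t (X j t) - s t (X i t))
      = - landauA d γ (X i t - X j t) (s t (X i t) - s t (X j t)) := by
    intro t i j
    rw [← landauA_neg_aux, neg_sub, neg_sub]
  constructor
  · congr 1
    refine const_aux (fun t => ∑ i, X i t) (fun t ht => ?_) t ht
    have h := HasDerivAt.fun_sum (u := Finset.univ) (fun i _ => hODE i t ht)
    convert h using 1
    rw [← Finset.smul_sum]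
    have h0 : ∑ i, ∑ j, landauA d γ (X i t - X j t) (s t (X i t) - s t (X j t)) = 0 := by
      have : IsAddTorsionFree (EuclideanSpace ℝ (Fin d)) := IsAddTorsionFree.of_module_rat _
      rw [← self_eq_neg]
      conv_lhs => rw [Finset.sum_comm]
      simp_rw [← Finset.sum_neg_distrib, ← hanti]
    rw [h0, smul_zero]
  · congr 1
    refine const_aux (fun t => ∑ i, ‖X i t‖ ^ 2) (fun t ht => ?_) t ht
    have h := HasDerivAt.fun_sum (u := Finset.univ) (fun i _ => (hODE i t ht).norm_sq)
    convert h using 1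
    set F : Fin n → Fin n → EuclideanSpace ℝ (Fin d) := fun i j =>
      landauA d γ (X i t - X j t) (s t (X i t) - s t (X j t)) with hF
    have h0 : ∑ i, ∑ j, ⟪X i t, F i j⟫ = 0 := by
      have h1 : ∑ i, ∑ j, ⟪X i t, F i j⟫ = ∑ i, ∑ j, -⟪X i t, F i j⟫ := by
        conv_rhs => rw [Finset.sum_comm]
        refine Finset.sum_congr rfl fun i _ => Finset.sum_congr rfl fun j _ => ?_
        have h2 : ⟪X i t - X j t, F i j⟫ = 0 := inner_landauA_aux d γ _ _
        have h3 : F j i = - F i j := hanti t i j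
        rw [inner_sub_left] at h2
        rw [h3, inner_neg_right]
        linarith
      simp_rw [Finset.sum_neg_distrib] at h1
      linarith
    simp_rw [inner_smul_right, inner_sum]
    rw [← Finset.mul_sum, ← Finset.mul_sum]
    rw [h0]
    simp
end

section
/- Let n ≥ 1, γ ∈ ℝ, A the Landau collision kernel on ℝ^d, s : ℝ^d → ℝ^d, Δt > 0, and let points X_1^k, …, X_n^k ∈ ℝ^d be updated by the forward-Euler scheme X_i^{k+1} = X_i^k − (Δt/n) ∑_{j=1}^n A(X_i^k − X_j^k)(s(X_i^k) − s(X_j^k)). Then the empirical momentum is exactly conserved at each step: (1/n) ∑_{i=1}^n X_i^{k+1} = (1/n) ∑_{i=1}^n X_i^k. -/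
open MeasureTheory
open scoped RealInnerProductSpace

/-- The forward-Euler scheme
`Xᵢ^{k+1} = Xᵢ^k − (Δt/n) ∑ⱼ A(Xᵢ^k−Xⱼ^k)(s(Xᵢ^k)−s(Xⱼ^k))` exactly conserves the
empirical momentum: `(1/n) ∑ᵢ Xᵢ^{k+1} = (1/n) ∑ᵢ Xᵢ^k`. -/
theorem forward_euler_momentum_conservation (d n : ℕ) (hn : 1 ≤ n) (γ : ℝ)
    (s : EuclideanSpace ℝ (Fin d) → EuclideanSpace ℝ (Fin d))
    (Δt : ℝ) (hΔt : 0 < Δt)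
    (X Xnext : Fin n → EuclideanSpace ℝ (Fin d))
    (hupd : ∀ i, Xnext i
      = X i - (Δt / (n : ℝ)) • ∑ j, landauA d γ (X i - X j) (s (X i) - s (X j))) :
    (1 / (n : ℝ)) • ∑ i, Xnext i = (1 / (n : ℝ)) • ∑ i, X i := by
  have hanti : ∀ i j, landauA d γ (X i - X j) (s (X i) - s (X j))
      = - landauA d γ (X j - X i) (s (X j) - s (X i)) := by
    intro i j
    rw [← neg_sub (X j) (X i), ← neg_sub (s (X j)) (s (X i))]
    simp only [landauA, norm_neg, inner_neg_neg]
    rw [← smul_neg]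
    congr 1
    simp only [smul_neg]
    abel
  have hS : ∑ i, ∑ j, landauA d γ (X i - X j) (s (X i) - s (X j)) = 0 := by
    have h : ∑ i, ∑ j, landauA d γ (X i - X j) (s (X i) - s (X j))
        = - ∑ i, ∑ j, landauA d γ (X i - X j) (s (X i) - s (X j)) := by
      conv_lhs => rw [Finset.sum_comm]
      simp only [← Finset.sum_neg_distrib]
      exact Finset.sum_congr rfl fun i _ => Finset.sum_congr rfl fun j _ => hanti j i
    have := IsAddTorsionFree.of_module_rat (EuclideanSpace ℝ (Fin d))
    exact self_eq_neg.mp h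
  simp only [hupd, Finset.sum_sub_distrib, ← Finset.smul_sum, hS, smul_zero, sub_zero]
end

section
/- Let u : ℝ^d → ℝ be a continuously differentiable, everywhere positive probability density with finite second moment, mean V = ∫ x u(x) dx, and let A be the Maxwellian Landau kernel (γ = 0). Assume that for every x ∈ ℝ^d and every row index i the integration-by-parts identity ∫ ∇_y · ( A_{i·}(x−y) u(y) ) dy = 0 holds (where A_{i·} denotes the i-th row of A), and that all integrals below are finite. Then the Landau velocity field v(x) = −∫ A(x−y)(∇ log u(x) − ∇ log u(y)) u(y) dy can be written in Fokker-Planck form: v(x) = −(d−1)(x − V) − (A∗u)(x) ∇ log u(x). -/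
open MeasureTheory
open scoped RealInnerProductSpace

/-- The entries of the Landau collision kernel:
`A_{ij}(z) = |z|^γ (|z|² δ_{ij} − z_i z_j)`. -/
noncomputable def landauEntry (d : ℕ) (γ : ℝ) (z : EuclideanSpace ℝ (Fin d)) (i j : Fin d) : ℝ :=
  ‖z‖ ^ γ * (‖z‖ ^ 2 * (if i = j then 1 else 0) - z i * z j)

/-- The score `∇ log u` of a positive density `u`. -/
noncomputable def score (d : ℕ) (u : EuclideanSpace ℝ (Fin d) → ℝ) :
    EuclideanSpace ℝ (Fin d) → EuclideanSpace ℝ (Fin d) :=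
  gradient fun x => Real.log (u x)

theorem aux_entry (d : ℕ) (x y : EuclideanSpace ℝ (Fin d)) (i j : Fin d) :
    DifferentiableAt ℝ (fun w => landauEntry d 0 (x - w) i j) y ∧
    fderiv ℝ (fun w => landauEntry d 0 (x - w) i j) y (EuclideanSpace.single j 1)
      = -(if i = j then (x - y) j else 0) + (x - y) i := by
  have hs : HasFDerivAt (fun w : EuclideanSpace ℝ (Fin d) => x - w)
      (-(ContinuousLinearMap.id ℝ (EuclideanSpace ℝ (Fin d)))) y :=
    (hasFDerivAt_id y).const_sub x
  have hc : ∀ k : Fin d, HasFDerivAt (fun w : EuclideanSpace ℝ (Fin d) => (x - w) k)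
      ((EuclideanSpace.proj k : EuclideanSpace ℝ (Fin d) →L[ℝ] ℝ).comp
        (-(ContinuousLinearMap.id ℝ (EuclideanSpace ℝ (Fin d))))) y := fun k =>
    (EuclideanSpace.proj k : EuclideanSpace ℝ (Fin d) →L[ℝ] ℝ).hasFDerivAt.comp y hs
  have h := (hs.norm_sq.mul_const (if i = j then (1 : ℝ) else 0)).sub ((hc i).mul (hc j))
  have he : (fun w => landauEntry d 0 (x - w) i j) =
      fun w => ‖x - w‖ ^ 2 * (if i = j then (1 : ℝ) else 0) - (x - w) i * (x - w) j := by
    funext w; simp [landauEntry]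
  rw [he]
  refine ⟨h.differentiableAt, ?_⟩
  have h2 := congrArg (fun L => L (EuclideanSpace.single j (1 : ℝ))) h.fderiv
  refine h2.trans ?_
  by_cases hij : i = j
  · subst hij
    simp [EuclideanSpace.inner_single_right]
    ring
  · simp [hij, EuclideanSpace.inner_single_right]

theorem aux_score (d : ℕ) (u : EuclideanSpace ℝ (Fin d) → ℝ) (hu : ContDiff ℝ 1 u)
    (hupos : ∀ x, 0 < u x) (y : EuclideanSpace ℝ (Fin d)) (j : Fin d) :
    fderiv ℝ u y (EuclideanSpace.single j 1) = u y * score d u y j := by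
  have hd : DifferentiableAt ℝ u y := hu.differentiable (by norm_num) y
  have h1 : ⟪score d u y, EuclideanSpace.single j (1 : ℝ)⟫ = score d u y j := by
    simp [EuclideanSpace.inner_single_right]
  rw [← h1]
  unfold score
  rw [gradient, InnerProductSpace.toDual_symm_apply, fderiv.log hd (hupos y).ne']
  have := (hupos y).ne'
  simp
  field_simp

theorem aux_pt (d : ℕ) (u : EuclideanSpace ℝ (Fin d) → ℝ) (hu : ContDiff ℝ 1 u)
    (hupos : ∀ x, 0 < u x) (x y : EuclideanSpace ℝ (Fin d)) (i : Fin d) :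
    ∑ j, fderiv ℝ (fun w => u w * landauEntry d 0 (x - w) i j) y (EuclideanSpace.single j 1)
      = (u y • landauA d 0 (x - y) (score d u y) + ((d : ℝ) - 1) • (u y • (x - y))) i := by
  have hd : DifferentiableAt ℝ u y := hu.differentiable (by norm_num) y
  have hj : ∀ j, fderiv ℝ (fun w => u w * landauEntry d 0 (x - w) i j) y
      (EuclideanSpace.single j 1) =
      u y * (-(if i = j then (x - y) j else 0) + (x - y) i)
      + landauEntry d 0 (x - y) i j * (u y * score d u y j) := by
    intro j
    obtain ⟨h1, h2⟩ := aux_entry d x y i j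
    have := fderiv_fun_mul hd h1
    rw [this, ← h2, ← aux_score d u hu hupos]
    simp
  simp_rw [hj]
  have hin : ⟪x - y, score d u y⟫ = ∑ j, (x - y) j * score d u y j := by
    rw [PiLp.inner_apply]
    exact Finset.sum_congr rfl fun j _ => by simp [mul_comm]
  have hz : ∀ z : EuclideanSpace ℝ (Fin d), ∀ s : EuclideanSpace ℝ (Fin d), ∀ c : ℝ,
      ∑ j, landauEntry d 0 z i j * (c * s j) = c * (‖z‖ ^ 2 * s i - (∑ j, z j * s j) * z i) := by
    intro z s c
    have : ∀ j, landauEntry d 0 z i j * (c * s j) =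
        (if i = j then c * ‖z‖ ^ 2 * s j else 0) - c * z i * (z j * s j) := by
      intro j
      by_cases h : i = j <;> simp [landauEntry, h] <;> ring
    simp_rw [this]
    rw [Finset.sum_sub_distrib, ← Finset.mul_sum, Finset.sum_ite_eq]
    simp
    ring
  rw [Finset.sum_add_distrib, hz, ← hin, ← Finset.mul_sum, Finset.sum_add_distrib,
    Finset.sum_neg_distrib, Finset.sum_ite_eq]
  simp [landauA]
  ring

/-- Fokker-Planck form of the Maxwellian Landau velocity field:
`v(x) = −∫ A(x−y)(∇log u(x) − ∇log u(y)) u(y) dy = −(d−1)(x−V) − (A∗u)(x) ∇log u(x)`,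
assuming the integration-by-parts identity `∫ ∇_y·(A_{i·}(x−y) u(y)) dy = 0`. -/
theorem landau_velocity_fokker_planck_form (d : ℕ) (hd : 1 ≤ d)
    (u : EuclideanSpace ℝ (Fin d) → ℝ) (hu : ContDiff ℝ 1 u) (hupos : ∀ x, 0 < u x)
    (hunorm : ∫ x, u x = 1)
    (humom : Integrable fun x => ‖x‖ ^ 2 * u x)
    (V : EuclideanSpace ℝ (Fin d)) (hV : V = ∫ x, u x • x)
    (hibp : ∀ (x : EuclideanSpace ℝ (Fin d)) (i : Fin d),
      ∫ y, ∑ j, fderiv ℝ (fun w => u w * landauEntry d 0 (x - w) i j) y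
        (EuclideanSpace.single j 1) = 0)
    (hint1 : ∀ x, Integrable fun y =>
      u y • landauA d 0 (x - y) (score d u x - score d u y))
    (hint2 : ∀ x, Integrable fun y => u y • landauA d 0 (x - y) (score d u x))
    (hint3 : ∀ x, Integrable fun y => u y • landauA d 0 (x - y) (score d u y)) :
    ∀ x, -∫ y, u y • landauA d 0 (x - y) (score d u x - score d u y)
      = -(((d : ℝ) - 1) • (x - V)) - ∫ y, u y • landauA d 0 (x - y) (score d u x) := by
  intro x
  have hui : Integrable u := by
    by_contra h
    rw [integral_undef h] at hunorm
    norm_num at hunorm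
  have hui2 : Integrable fun y => u y • y := by
    refine (hui.add humom).mono'
      ((hu.continuous.smul continuous_id).aestronglyMeasurable) (Filter.Eventually.of_forall ?_)
    intro y
    have := hupos y
    simp only [norm_smul, Real.norm_eq_abs, abs_of_pos this, Pi.add_apply]
    nlinarith [mul_nonneg this.le (sq_nonneg (‖y‖ - 1)), mul_nonneg this.le (sq_nonneg ‖y‖)]
  have hxi : Integrable fun y => u y • (x - y) := by
    simp only [smul_sub]
    exact (hui.smul_const x).sub hui2
  have hx : ∫ y, u y • (x - y) = x - V := by
    simp only [smul_sub]
    rw [integral_sub (hui.smul_const x) hui2, integral_smul_const, hunorm, one_smul, hV]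
  have hF : Integrable fun y => u y • landauA d 0 (x - y) (score d u y)
      + ((d : ℝ) - 1) • (u y • (x - y)) := (hint3 x).add (hxi.smul ((d : ℝ) - 1))
  have h0 : ∫ y, (u y • landauA d 0 (x - y) (score d u y)
      + ((d : ℝ) - 1) • (u y • (x - y))) = 0 := by
    ext i
    have h1 := hibp x i
    simp_rw [aux_pt d u hu hupos] at h1
    have h2 := (EuclideanSpace.proj i : EuclideanSpace ℝ (Fin d) →L[ℝ] ℝ).integral_comp_comm hF
    exact h2.symm.trans h1
  have hxs : Integrable fun y => ((d : ℝ) - 1) • (u y • (x - y)) := hxi.smul ((d : ℝ) - 1)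
  rw [integral_add (hint3 x) hxs, integral_smul, hx] at h0
  have hsub : ∀ y, u y • landauA d 0 (x - y) (score d u x - score d u y) =
      u y • landauA d 0 (x - y) (score d u x) - u y • landauA d 0 (x - y) (score d u y) := by
    intro y
    simp only [landauA, inner_sub_right]
    module
  simp_rw [hsub]
  rw [integral_sub (hint2 x) (hint3 x), eq_neg_of_add_eq_zero_left h0]
  abel
end

section
/- Fix t and let u, u* : ℝ^d → ℝ be continuously differentiable, everywhere positive probability densities, s : ℝ^d → ℝ^d a vector field, b : ℝ^d → ℝ^d a drift, and D : ℝ^d → (symmetric positive semi-definite d×d matrices). Set v = b − D s and v* = b − D ∇ log u*. Suppose the map τ ↦ KL(u_τ‖u*_τ) = ∫ u_τ log(u_τ/u*_τ) dx is differentiable at t with derivative equal to ∫ ⟨v(x) − v*(x), ∇ log u(x) − ∇ log u*(x)⟩ u(x) dx (the standard dissipation formula, valid under sufficient regularity), and that the integrals ∫ |∇ log u − s|²_D u dx and ∫ |∇ log u − ∇ log u*|²_D u dx are finite. Then (d/dt) KL(u_t‖u*_t) ≤ (1/2) ∫ |s − ∇ log u|²_D u dx. -/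
open MeasureTheory
open scoped RealInnerProductSpace

/-- KL bound for the score-approximated Fokker-Planck equation: if the time-derivative
of `KL(u_t‖u*_t)` equals the dissipation `∫ ⟨v − v*, ∇log u − ∇log u*⟩ u dx` with
`v = b − D s` and `v* = b − D ∇log u*`, and `D` is symmetric positive semi-definite, then
`(d/dt) KL(u_t‖u*_t) ≤ ½ ∫ |s − ∇log u|²_D u dx`. -/
theorem kl_bound_fokker_planck (d : ℕ) (hd : 1 ≤ d)
    (u ustar : ℝ → EuclideanSpace ℝ (Fin d) → ℝ) (t : ℝ)
    (hu : ContDiff ℝ 1 (u t)) (hustar : ContDiff ℝ 1 (ustar t))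
    (hupos : ∀ x, 0 < u t x) (hustarpos : ∀ x, 0 < ustar t x)
    (hunorm : ∫ x, u t x = 1) (hustarnorm : ∫ x, ustar t x = 1)
    (s b : EuclideanSpace ℝ (Fin d) → EuclideanSpace ℝ (Fin d))
    (D : EuclideanSpace ℝ (Fin d) → EuclideanSpace ℝ (Fin d) →L[ℝ] EuclideanSpace ℝ (Fin d))
    (hDsymm : ∀ x w w', ⟪w, D x w'⟫ = ⟪D x w, w'⟫)
    (hDpsd : ∀ x w, 0 ≤ ⟪w, D x w⟫)
    (KL : ℝ → ℝ)
    (hKL : ∀ τ, KL τ = ∫ x, u τ x * Real.log (u τ x / ustar τ x))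
    (hderiv : HasDerivAt KL
      (∫ x, ⟪(b x - D x (s x)) - (b x - D x (score d (ustar t) x)),
          score d (u t) x - score d (ustar t) x⟫ * u t x) t)
    (hfin1 : Integrable fun x =>
      ⟪score d (u t) x - s x, D x (score d (u t) x - s x)⟫ * u t x)
    (hfin2 : Integrable fun x =>
      ⟪score d (u t) x - score d (ustar t) x,
        D x (score d (u t) x - score d (ustar t) x)⟫ * u t x) :
    deriv KL t ≤ (1 / 2) * ∫ x, ⟪s x - score d (u t) x, D x (s x - score d (u t) x)⟫ * u t x := by
  rw [hderiv.deriv]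
  have hneg : ∀ x, ⟪s x - score d (u t) x, D x (s x - score d (u t) x)⟫
      = ⟪score d (u t) x - s x, D x (score d (u t) x - s x)⟫ := by
    intro x
    rw [← neg_sub (score d (u t) x) (s x), map_neg, inner_neg_neg]
  simp only [hneg]
  rw [← integral_const_mul]
  have hnn : ∀ x, 0 ≤ 1 / 2 *
      (⟪score d (u t) x - s x, D x (score d (u t) x - s x)⟫ * u t x) := fun x =>
    mul_nonneg (by norm_num) (mul_nonneg (hDpsd x _) (hupos x).le)
  have key : ∀ x, ⟪(b x - D x (s x)) - (b x - D x (score d (ustar t) x)),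
          score d (u t) x - score d (ustar t) x⟫ * u t x ≤ 1 / 2 *
      (⟪score d (u t) x - s x, D x (score d (u t) x - s x)⟫ * u t x) := by
    intro x
    rw [← mul_assoc]
    refine mul_le_mul_of_nonneg_right ?_ (hupos x).le
    generalize ha : score d (u t) x - score d (ustar t) x = a
    generalize he : score d (u t) x - s x = e
    have h1 : (b x - D x (s x)) - (b x - D x (score d (ustar t) x)) = D x (e - a) := by
      rw [← ha, ← he]
      simp only [map_sub]
      abel
    rw [h1]
    have h2 := hDpsd x (e - a)
    have h3 := hDpsd x a
    have h4 := hDsymm x e a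
    have h5 := hDsymm x a a
    have h6 := real_inner_comm (D x e) a
    simp only [map_sub, inner_sub_left, inner_sub_right] at h2 ⊢
    linarith
  by_cases hi : Integrable fun x => ⟪(b x - D x (s x)) - (b x - D x (score d (ustar t) x)),
          score d (u t) x - score d (ustar t) x⟫ * u t x
  · exact integral_mono hi (hfin1.const_mul _) key
  · rw [integral_undef hi]
    exact integral_nonneg hnn
end

section
/- Let u, u* : ℝ^d → ℝ be continuously differentiable, everywhere positive probability densities with finite second moments, s : ℝ^d → ℝ^d a vector field, and A the Maxwellian Landau kernel (γ = 0). Define v(x) = −∫ A(x−y)(s(x) − s(y)) u(y) dy and v̄(x) = −∫ A(x−y)(∇ log u(x) − ∇ log u(y)) u(y) dy. Assume the integrals ∫ |∇ log u − s|²_{A∗u} u dx and ∫ |∇ log u − ∇ log u*|²_{A∗u} u dx are finite and that all intermediate integrals converge absolutely. Then ∫ ⟨v(x) − v̄(x), ∇ log u(x) − ∇ log u*(x)⟩ u(x) dx ≤ 2 ∫ |∇ log u − s|²_{A∗u} u dx + (1/2) ∫ |∇ log u − ∇ log u*|²_{A∗u} u dx. -/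
open MeasureTheory
open scoped RealInnerProductSpace

lemma landauA_zero_apply (d : ℕ) (z w : EuclideanSpace ℝ (Fin d)) :
    landauA d 0 z w = ‖z‖ ^ 2 • w - ⟪z, w⟫ • z := by
  simp [landauA]

lemma landauA_symm_arg (d : ℕ) (x y w : EuclideanSpace ℝ (Fin d)) :
    landauA d 0 (x - y) w = landauA d 0 (y - x) w := by
  rw [← neg_sub y x, landauA_zero_apply, landauA_zero_apply, norm_neg, inner_neg_left, smul_neg,
    neg_smul, neg_neg]

lemma landauA_sub (d : ℕ) (z a b : EuclideanSpace ℝ (Fin d)) :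
    landauA d 0 z (a - b) = landauA d 0 z a - landauA d 0 z b := by
  simp only [landauA_zero_apply, inner_sub_right, smul_sub, sub_smul]
  abel

lemma landauA_nonneg (d : ℕ) (z w : EuclideanSpace ℝ (Fin d)) :
    0 ≤ ⟪w, landauA d 0 z w⟫ := by
  rw [landauA_zero_apply, inner_sub_right, inner_smul_right, inner_smul_right,
    real_inner_self_eq_norm_sq, real_inner_comm z w]
  have h := abs_real_inner_le_norm z w
  have h2 := sq_le_sq' (by linarith [neg_abs_le ⟪z, w⟫, norm_nonneg z, norm_nonneg w,
    (abs_le.mp h).1]) (abs_le.mp h).2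
  nlinarith

lemma landauA_young (d : ℕ) (z a b f : EuclideanSpace ℝ (Fin d)) :
    ⟪landauA d 0 z (a - b), f⟫ ≤
      ⟪a, landauA d 0 z a⟫ + ⟪b, landauA d 0 z b⟫ + (1 / 2) * ⟪f, landauA d 0 z f⟫ := by
  have h1 := landauA_nonneg d z (a - (1 / 2 : ℝ) • f)
  have h2 := landauA_nonneg d z (b + (1 / 2 : ℝ) • f)
  simp only [landauA_zero_apply, inner_sub_right, inner_sub_left, inner_add_right,
    inner_add_left, inner_smul_right, inner_smul_left, RCLike.conj_to_real] at *
  rw [real_inner_comm a f, real_inner_comm a z, real_inner_comm f z] at *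
  rw [real_inner_comm b f, real_inner_comm b z] at *
  nlinarith

lemma landauA_integrable (d : ℕ) (u : EuclideanSpace ℝ (Fin d) → ℝ) (hu : Continuous u)
    (hupos : ∀ x, 0 < u x) (hi : Integrable u)
    (humom : Integrable fun x => ‖x‖ ^ 2 * u x) (x w : EuclideanSpace ℝ (Fin d)) :
    Integrable fun y => u y • landauA d 0 (x - y) w := by
  have hb : Integrable fun y => (4 * ‖w‖ * ‖x‖ ^ 2) * u y + (4 * ‖w‖) * (‖y‖ ^ 2 * u y) :=
    (hi.const_mul _).add (humom.const_mul _)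
  refine hb.mono' ?_ ?_
  · simp only [landauA_zero_apply]
    exact Continuous.aestronglyMeasurable (by fun_prop)
  · refine Filter.Eventually.of_forall fun y => ?_
    rw [norm_smul, Real.norm_of_nonneg (hupos y).le, landauA_zero_apply]
    have h1 : ‖‖x - y‖ ^ 2 • w - ⟪x - y, w⟫ • (x - y)‖ ≤ 2 * ‖x - y‖ ^ 2 * ‖w‖ := by
      refine (norm_sub_le _ _).trans ?_
      rw [norm_smul, norm_smul, Real.norm_of_nonneg (by positivity)]
      have := norm_inner_le_norm (𝕜 := ℝ) (x - y) w
      nlinarith [norm_nonneg (x - y)]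
    have h2 : ‖x - y‖ ^ 2 ≤ 2 * ‖x‖ ^ 2 + 2 * ‖y‖ ^ 2 := by
      have := norm_sub_le x y
      nlinarith [norm_nonneg (x - y), norm_nonneg x, norm_nonneg y, sq_nonneg (‖x‖ - ‖y‖)]
    have h3 : 2 * ‖x - y‖ ^ 2 * ‖w‖ ≤ 2 * (2 * ‖x‖ ^ 2 + 2 * ‖y‖ ^ 2) * ‖w‖ := by
      gcongr
    have := mul_le_mul_of_nonneg_left (h1.trans h3) (hupos y).le
    linarith

lemma inner_D_eq (d : ℕ) (u : EuclideanSpace ℝ (Fin d) → ℝ) (x w : EuclideanSpace ℝ (Fin d))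
    (h : Integrable fun y => u y • landauA d 0 (x - y) w) :
    ⟪w, ∫ y, u y • landauA d 0 (x - y) w⟫ * u x
      = ∫ y, u x * u y * ⟪w, landauA d 0 (x - y) w⟫ := by
  rw [← integral_inner h w, ← integral_mul_const]
  refine integral_congr_ae (Filter.Eventually.of_forall fun y => ?_)
  simp only [inner_smul_right]
  ring

/-- Young-inequality estimate for the Landau KL bound: with `v` the score-approximated
velocity and `v̄` the exact-score velocity (both built from `u`),
`∫ ⟨v − v̄, ∇log u − ∇log u*⟩ u ≤ 2 ∫ |∇log u − s|²_{A∗u} u + ½ ∫ |∇log u − ∇log u*|²_{A∗u} u`. -/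
theorem landau_velocity_difference_bound (d : ℕ) (hd : 1 ≤ d)
    (u ustar : EuclideanSpace ℝ (Fin d) → ℝ)
    (hu : ContDiff ℝ 1 u) (hustar : ContDiff ℝ 1 ustar)
    (hupos : ∀ x, 0 < u x) (hustarpos : ∀ x, 0 < ustar x)
    (hunorm : ∫ x, u x = 1) (hustarnorm : ∫ x, ustar x = 1)
    (humom : Integrable fun x => ‖x‖ ^ 2 * u x)
    (hustarmom : Integrable fun x => ‖x‖ ^ 2 * ustar x)
    (s : EuclideanSpace ℝ (Fin d) → EuclideanSpace ℝ (Fin d))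
    -- the convolution matrix `D = A∗u` and the velocity fields `v`, `v̄`
    (D : EuclideanSpace ℝ (Fin d) → EuclideanSpace ℝ (Fin d) → EuclideanSpace ℝ (Fin d))
    (hD : ∀ x w, D x w = ∫ y, u y • landauA d 0 (x - y) w)
    (v vbar : EuclideanSpace ℝ (Fin d) → EuclideanSpace ℝ (Fin d))
    (hv : ∀ x, v x = -∫ y, u y • landauA d 0 (x - y) (s x - s y))
    (hvbar : ∀ x, vbar x = -∫ y, u y • landauA d 0 (x - y) (score d u x - score d u y))
    -- finiteness of the two score-matching integrals
    (hfin1 : Integrable fun x => ⟪score d u x - s x, D x (score d u x - s x)⟫ * u x)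
    (hfin2 : Integrable fun x =>
      ⟪score d u x - score d ustar x, D x (score d u x - score d ustar x)⟫ * u x)
    -- absolute convergence of the intermediate integrals
    (hLHS : Integrable fun x => ⟪v x - vbar x, score d u x - score d ustar x⟫ * u x)
    (hv_int : ∀ x, Integrable fun y => u y • landauA d 0 (x - y) (s x - s y))
    (hvbar_int : ∀ x, Integrable fun y =>
      u y • landauA d 0 (x - y) (score d u x - score d u y))
    (hprod1 : Integrable
      (fun p : EuclideanSpace ℝ (Fin d) × EuclideanSpace ℝ (Fin d) =>
        u p.1 * u p.2 *
          ⟪score d u p.2 - s p.2, landauA d 0 (p.1 - p.2) (score d u p.2 - s p.2)⟫)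
      (volume.prod volume))
    (hprod2 : Integrable
      (fun p : EuclideanSpace ℝ (Fin d) × EuclideanSpace ℝ (Fin d) =>
        u p.1 * u p.2 *
          ⟪score d u p.1 - score d ustar p.1,
            landauA d 0 (p.1 - p.2) (score d u p.1 - score d ustar p.1)⟫)
      (volume.prod volume)) :
    ∫ x, ⟪v x - vbar x, score d u x - score d ustar x⟫ * u x
      ≤ 2 * (∫ x, ⟪score d u x - s x, D x (score d u x - s x)⟫ * u x)
        + (1 / 2) * ∫ x,
            ⟪score d u x - score d ustar x, D x (score d u x - score d ustar x)⟫ * u x := by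
  have hi : Integrable u := by
    by_contra h
    rw [integral_undef h] at hunorm
    exact zero_ne_one hunorm
  have hAint := landauA_integrable d u hu.continuous hupos hi humom
  set e : EuclideanSpace ℝ (Fin d) → EuclideanSpace ℝ (Fin d) := fun x => score d u x - s x with he
  set f : EuclideanSpace ℝ (Fin d) → EuclideanSpace ℝ (Fin d) :=
    fun x => score d u x - score d ustar x with hf
  have hprod1' : Integrable (fun p : EuclideanSpace ℝ (Fin d) × EuclideanSpace ℝ (Fin d) =>
        u p.1 * u p.2 * ⟪e p.2, landauA d 0 (p.1 - p.2) (e p.2)⟫) (volume.prod volume) := hprod1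
  have hprod2' : Integrable (fun p : EuclideanSpace ℝ (Fin d) × EuclideanSpace ℝ (Fin d) =>
        u p.1 * u p.2 * ⟪f p.1, landauA d 0 (p.1 - p.2) (f p.1)⟫) (volume.prod volume) := hprod2
  have hprod3 : Integrable (fun p : EuclideanSpace ℝ (Fin d) × EuclideanSpace ℝ (Fin d) =>
        u p.1 * u p.2 * ⟪e p.1, landauA d 0 (p.1 - p.2) (e p.1)⟫) (volume.prod volume) := by
    refine hprod1'.swap.congr (Filter.Eventually.of_forall fun p => ?_)
    simp only [Function.comp, Prod.fst_swap, Prod.snd_swap]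
    rw [landauA_symm_arg d p.2 p.1, mul_comm (u p.2)]
  have hE : ∀ x, ⟪e x, D x (e x)⟫ * u x
      = ∫ y, u x * u y * ⟪e x, landauA d 0 (x - y) (e x)⟫ := fun x => by
    rw [hD, inner_D_eq d u x (e x) (hAint x _)]
  have hF : ∀ x, ⟪f x, D x (f x)⟫ * u x
      = ∫ y, u x * u y * ⟪f x, landauA d 0 (x - y) (f x)⟫ := fun x => by
    rw [hD, inner_D_eq d u x (f x) (hAint x _)]
  have hswap : ∫ x, ∫ y, u x * u y * ⟪e y, landauA d 0 (x - y) (e y)⟫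
      = ∫ x, ∫ y, u x * u y * ⟪e x, landauA d 0 (x - y) (e x)⟫ := by
    rw [integral_integral_swap hprod1']
    refine integral_congr_ae (Filter.Eventually.of_forall fun x => ?_)
    refine integral_congr_ae (Filter.Eventually.of_forall fun y => ?_)
    simp only
    rw [landauA_symm_arg d y x, mul_comm (u y)]
  have hgint : ∀ x, Integrable fun y => u y • landauA d 0 (x - y) (e x - e y) := fun x => by
    refine ((hvbar_int x).sub (hv_int x)).congr (Filter.Eventually.of_forall fun y => ?_)
    simp only [Pi.sub_apply]
    rw [← smul_sub, ← landauA_sub]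
    congr 2
    simp only [he]
    abel
  have hdiff : ∀ x, v x - vbar x = ∫ y, u y • landauA d 0 (x - y) (e x - e y) := fun x => by
    rw [hv, hvbar, neg_sub_neg, ← integral_sub (hvbar_int x) (hv_int x)]
    refine integral_congr_ae (Filter.Eventually.of_forall fun y => ?_)
    simp only
    rw [← smul_sub, ← landauA_sub]
    congr 2
    simp only [he]
    abel
  have hL : ∀ x, ⟪v x - vbar x, f x⟫ * u x
      = ∫ y, u x * u y * ⟪landauA d 0 (x - y) (e x - e y), f x⟫ := fun x => by
    rw [hdiff, real_inner_comm, ← integral_inner (hgint x) (f x), ← integral_mul_const]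
    refine integral_congr_ae (Filter.Eventually.of_forall fun y => ?_)
    simp only [inner_smul_right]
    rw [real_inner_comm]
    ring
  have hLi : ∀ x, Integrable fun y => u x * u y * ⟪landauA d 0 (x - y) (e x - e y), f x⟫ :=
    fun x => by
    refine (((hgint x).const_inner (𝕜 := ℝ) (f x)).mul_const (u x)).congr
      (Filter.Eventually.of_forall fun y => ?_)
    simp only [inner_smul_right]
    rw [real_inner_comm]
    ring
  have key : ∫ x, ⟪v x - vbar x, f x⟫ * u x ≤
      ∫ x, ((∫ y, u x * u y * ⟪e x, landauA d 0 (x - y) (e x)⟫)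
        + (∫ y, u x * u y * ⟪e y, landauA d 0 (x - y) (e y)⟫)
        + (1 / 2) * ∫ y, u x * u y * ⟪f x, landauA d 0 (x - y) (f x)⟫) := by
    refine integral_mono_ae hLHS ((hprod3.integral_prod_left.add
      hprod1'.integral_prod_left).add (hprod2'.integral_prod_left.const_mul _)) ?_
    filter_upwards [hprod1'.prod_right_ae, hprod2'.prod_right_ae, hprod3.prod_right_ae]
      with x h1 h2 h3
    have h31 : Integrable fun y => u x * u y * ⟪e x, landauA d 0 (x - y) (e x)⟫
        + u x * u y * ⟪e y, landauA d 0 (x - y) (e y)⟫ := h3.add h1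
    have h4 := hL x
    rw [h4, ← integral_const_mul, ← integral_add h3 h1,
      ← integral_add h31 (h2.const_mul _)]
    refine integral_mono (hLi x) ((h3.add h1).add (h2.const_mul _)) fun y => ?_
    have := mul_le_mul_of_nonneg_left (landauA_young d (x - y) (e x) (e y) (f x))
      (mul_pos (hupos x) (hupos y)).le
    simp only [Pi.add_apply]
    linarith
  have I1 : Integrable fun x => ∫ y, u x * u y * ⟪e y, landauA d 0 (x - y) (e y)⟫ :=
    hprod1'.integral_prod_left
  have I2 : Integrable fun x => ∫ y, u x * u y * ⟪f x, landauA d 0 (x - y) (f x)⟫ :=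
    hprod2'.integral_prod_left
  have I3 : Integrable fun x => ∫ y, u x * u y * ⟪e x, landauA d 0 (x - y) (e x)⟫ :=
    hprod3.integral_prod_left
  have I31 : Integrable fun x => (∫ y, u x * u y * ⟪e x, landauA d 0 (x - y) (e x)⟫)
    + ∫ y, u x * u y * ⟪e y, landauA d 0 (x - y) (e y)⟫ := I3.add I1
  rw [integral_add I31 (I2.const_mul _), integral_add I3 I1, integral_const_mul] at key
  have hE' := integral_congr_ae (μ := volume) (Filter.Eventually.of_forall hE)
  have hF' := integral_congr_ae (μ := volume) (Filter.Eventually.of_forall hF)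
  rw [hswap, ← hE', ← hF'] at key
  linarith
end

section
/- Fix T > 0, constants C₁, C₃, ε, E, β > 0, and let d ≥ 1. For τ ∈ [0,T] let u_τ, u*_τ : ℝ^d → ℝ be continuously differentiable, everywhere positive probability densities with equal means and equal energy 2E, second moment matrices Σ(τ), Σ*(τ), and let s_τ : ℝ^d → ℝ^d. Define the score-matching loss ℓ(τ) = ∫ |∇ log u_τ − s_τ|²_{A∗u_τ} u_τ dx with A the Maxwellian Landau kernel (γ = 0), and KL(τ) = ∫ u_τ log(u_τ/u*_τ) dx. Let M = (4 C₁ / ε) (1 + E) d² C₃² (1 + T). Fix t ∈ [0,T] and assume: (i) KL(0) = 0, KL is continuous on [0,t] and differentiable on (0,t), with derivative satisfying, for all τ ∈ (0,t), KL'(τ) ≤ 2 ℓ(τ) − (1/2) ∫ |∇ log u_τ − ∇ log u*_τ|²_{A∗u_τ} u_τ dx + ∫ ⟨∇ log u*_τ, (Σ(τ) − Σ*(τ))(∇ log u_τ − ∇ log u*_τ)⟩ u_τ dx; (ii) (A∗u_τ)(x) − ε I is positive semi-definite for all τ ∈ [0,t] and x ∈ ℝ^d; (iii) ∫ |∇ log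 u*_τ|² u_τ dx ≤ 8 C₁ (1 + τ)(1 + E) for all τ ∈ [0,t]; (iv) the weighted Csiszár–Kullback–Pinsker consequence ∫ |x|² |u_τ − u*_τ| dx ≤ C₃ (KL(τ))^{1/2} holds for all τ ∈ [0,t]; (v) the quantities in (i) are finite and τ ↦ ℓ(τ) is integrable on [0,t]. Then KL(t) ≤ 2 e^{M t} ∫₀ᵗ ℓ(τ) dτ. -/
open MeasureTheory
open scoped RealInnerProductSpace

lemma aux_int {d : ℕ} (f : EuclideanSpace ℝ (Fin d) → ℝ) (hf : Continuous f)
    (hi : Integrable fun x => ‖x‖ ^ 2 * f x) (i j : Fin d) :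
    Integrable fun x : EuclideanSpace ℝ (Fin d) => x i * x j * f x := by
  refine hi.mono (Continuous.aestronglyMeasurable (by fun_prop)) (Filter.Eventually.of_forall ?_)
  intro x
  have h1 := PiLp.norm_apply_le x i
  have h2 := PiLp.norm_apply_le x j
  simp only [norm_mul, norm_pow, norm_norm]
  gcongr
  rw [sq]
  gcongr

lemma aux_quad {d : ℕ} (f g : EuclideanSpace ℝ (Fin d) → ℝ) (hf : Continuous f)
    (hg : Continuous g)
    (hi : Integrable fun x => ‖x‖ ^ 2 * f x) (hj : Integrable fun x => ‖x‖ ^ 2 * g x)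
    (v w : EuclideanSpace ℝ (Fin d)) :
    ∑ i, ∑ j, v i * ((∫ x : EuclideanSpace ℝ (Fin d), x i * x j * f x)
      - ∫ x : EuclideanSpace ℝ (Fin d), x i * x j * g x) * w j
      ≤ ‖v‖ * ‖w‖ * ∫ x, ‖x‖ ^ 2 * |f x - g x| := by
  have hint : ∀ i j : Fin d, Integrable fun x : EuclideanSpace ℝ (Fin d) =>
      v i * (x i * x j * f x - x i * x j * g x) * w j := fun i j =>
    (((aux_int f hf hi i j).sub (aux_int g hg hj i j)).const_mul _).mul_const _
  have e : ∑ i, ∑ j, v i * ((∫ x : EuclideanSpace ℝ (Fin d), x i * x j * f x)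
      - ∫ x : EuclideanSpace ℝ (Fin d), x i * x j * g x) * w j
      = ∫ x : EuclideanSpace ℝ (Fin d),
        ∑ i, ∑ j, v i * (x i * x j * f x - x i * x j * g x) * w j := by
    rw [integral_finsetSum _ fun i _ => integrable_finsetSum _ fun j _ => hint i j]
    refine Finset.sum_congr rfl fun i _ => ?_
    rw [integral_finsetSum _ fun j _ => hint i j]
    refine Finset.sum_congr rfl fun j _ => ?_
    rw [integral_mul_const, integral_const_mul,
      integral_sub (aux_int f hf hi i j) (aux_int g hg hj i j)]
  rw [e, ← integral_const_mul]
  refine integral_mono (integrable_finsetSum _ fun i _ => integrable_finsetSum _ fun j _ => hint i j)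
    ?_ ?_
  · refine Integrable.const_mul ?_ _
    have := (hi.sub hj).abs
    refine this.congr (Filter.Eventually.of_forall fun x => ?_)
    simp only [Pi.sub_apply]
    rw [← mul_sub, abs_mul, abs_of_nonneg (sq_nonneg ‖x‖)]
  · intro x
    have e2 : ∑ i, ∑ j, v i * (x i * x j * f x - x i * x j * g x) * w j
        = ⟪v, x⟫ * ⟪x, w⟫ * (f x - g x) := by
      simp only [PiLp.inner_apply, RCLike.inner_apply, conj_trivial]
      rw [Finset.sum_mul_sum, Finset.sum_mul]
      refine Finset.sum_congr rfl fun i _ => ?_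
      rw [Finset.sum_mul]
      refine Finset.sum_congr rfl fun j _ => ?_
      ring
    simp only [e2]
    have h1 := abs_real_inner_le_norm v x
    have h2 := abs_real_inner_le_norm x w
    calc ⟪v, x⟫ * ⟪x, w⟫ * (f x - g x) ≤ |⟪v, x⟫ * ⟪x, w⟫ * (f x - g x)| := le_abs_self _
      _ = |⟪v, x⟫| * |⟪x, w⟫| * |f x - g x| := by rw [abs_mul, abs_mul]
      _ ≤ (‖v‖ * ‖x‖) * (‖x‖ * ‖w‖) * |f x - g x| := by gcongr
      _ = _ := by ring

lemma aux_gibbs {d : ℕ} (f g : EuclideanSpace ℝ (Fin d) → ℝ)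
    (hf : ∀ x, 0 < f x) (hg : ∀ x, 0 < g x) (h1 : ∫ x, f x = 1) (h2 : ∫ x, g x = 1) :
    0 ≤ ∫ x, f x * Real.log (f x / g x) := by
  by_cases hi : Integrable fun x => f x * Real.log (f x / g x)
  · have if' : Integrable f := by
      by_contra h; rw [integral_undef h] at h1; norm_num at h1
    have ig : Integrable g := by
      by_contra h; rw [integral_undef h] at h2; norm_num at h2
    have : ∫ x, (f x - g x) = 0 := by rw [integral_sub if' ig, h1, h2, sub_self]
    rw [← this]
    refine integral_mono (if'.sub ig) hi fun x => ?_
    have a := hf x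
    have b := hg x
    have := Real.one_sub_inv_le_log_of_pos (div_pos a b)
    calc f x - g x = f x * (1 - (f x / g x)⁻¹) := by field_simp
      _ ≤ _ := by gcongr
  · rw [integral_undef hi]

/-- Grönwall-type KL bound for the Landau equation with Maxwellian molecules:
under the dissipation inequality, the uniform ellipticity of `A∗u_τ`, the score growth
bound, and the weighted Csiszár–Kullback–Pinsker estimate, one has
`KL(t) ≤ 2 e^{Mt} ∫₀ᵗ ℓ(τ) dτ` with `M = (4C₁/ε)(1+E) d² C₃² (1+T)`. -/
theorem landau_kl_gronwall_bound (d : ℕ) (hd : 1 ≤ d)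
    (T C₁ C₃ ε En β : ℝ)
    (hT : 0 < T) (hC₁ : 0 < C₁) (hC₃ : 0 < C₃) (hε : 0 < ε) (hEn : 0 < En) (hβ : 0 < β)
    (u ustar : ℝ → EuclideanSpace ℝ (Fin d) → ℝ)
    (s : ℝ → EuclideanSpace ℝ (Fin d) → EuclideanSpace ℝ (Fin d))
    -- regularity, positivity, normalization on [0,T]
    (hu : ∀ τ ∈ Set.Icc (0 : ℝ) T, ContDiff ℝ 1 (u τ))
    (hustar : ∀ τ ∈ Set.Icc (0 : ℝ) T, ContDiff ℝ 1 (ustar τ))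
    (hupos : ∀ τ ∈ Set.Icc (0 : ℝ) T, ∀ x, 0 < u τ x)
    (hustarpos : ∀ τ ∈ Set.Icc (0 : ℝ) T, ∀ x, 0 < ustar τ x)
    (hunorm : ∀ τ ∈ Set.Icc (0 : ℝ) T, ∫ x, u τ x = 1)
    (hustarnorm : ∀ τ ∈ Set.Icc (0 : ℝ) T, ∫ x, ustar τ x = 1)
    -- equal means and equal energy `2E`
    (hmean : ∀ τ ∈ Set.Icc (0 : ℝ) T, (∫ x, u τ x • x) = ∫ x, ustar τ x • x)
    (henergy : ∀ τ ∈ Set.Icc (0 : ℝ) T, (∫ x, ‖x‖ ^ 2 * u τ x) = 2 * En)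
    (henergystar : ∀ τ ∈ Set.Icc (0 : ℝ) T, (∫ x, ‖x‖ ^ 2 * ustar τ x) = 2 * En)
    -- second moment matrices
    (Smat Sstarmat : ℝ → Fin d → Fin d → ℝ)
    (hSmat : ∀ τ i j, Smat τ i j = ∫ x, x i * x j * u τ x)
    (hSstarmat : ∀ τ i j, Sstarmat τ i j = ∫ x, x i * x j * ustar τ x)
    -- the convolution matrices `D τ = A∗u_τ`
    (D : ℝ → EuclideanSpace ℝ (Fin d) → EuclideanSpace ℝ (Fin d) → EuclideanSpace ℝ (Fin d))
    (hD : ∀ τ x w, D τ x w = ∫ y, u τ y • landauA d 0 (x - y) w)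
    -- the score-matching loss and the KL divergence
    (ℓ KL : ℝ → ℝ)
    (hℓ : ∀ τ, ℓ τ = ∫ x,
      ⟪score d (u τ) x - s τ x, D τ x (score d (u τ) x - s τ x)⟫ * u τ x)
    (hKL : ∀ τ, KL τ = ∫ x, u τ x * Real.log (u τ x / ustar τ x))
    -- the Grönwall constant
    (Mc : ℝ) (hMc : Mc = (4 * C₁ / ε) * (1 + En) * (d : ℝ) ^ 2 * C₃ ^ 2 * (1 + T))
    (t : ℝ) (ht : t ∈ Set.Icc (0 : ℝ) T)
    -- (i) the dissipation inequality
    (hKL0 : KL 0 = 0)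
    (hKLcont : ContinuousOn KL (Set.Icc 0 t))
    (hKLdiff : ∀ τ ∈ Set.Ioo (0 : ℝ) t, DifferentiableAt ℝ KL τ)
    (hKLderiv : ∀ τ ∈ Set.Ioo (0 : ℝ) t,
      deriv KL τ ≤ 2 * ℓ τ
        - (1 / 2) * (∫ x, ⟪score d (u τ) x - score d (ustar τ) x,
            D τ x (score d (u τ) x - score d (ustar τ) x)⟫ * u τ x)
        + ∫ x, (∑ i, ∑ j, score d (ustar τ) x i * (Smat τ i j - Sstarmat τ i j)
            * (score d (u τ) x j - score d (ustar τ) x j)) * u τ x)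
    -- (ii) uniform ellipticity of `A∗u_τ`
    (hellip : ∀ τ ∈ Set.Icc (0 : ℝ) t, ∀ x w, ε * ‖w‖ ^ 2 ≤ ⟪w, D τ x w⟫)
    -- (iii) score growth bound
    (hscore : ∀ τ ∈ Set.Icc (0 : ℝ) t,
      (∫ x, ‖score d (ustar τ) x‖ ^ 2 * u τ x) ≤ 8 * C₁ * (1 + τ) * (1 + En))
    -- (iv) weighted Csiszár–Kullback–Pinsker estimate
    (hCKP : ∀ τ ∈ Set.Icc (0 : ℝ) t,
      (∫ x, ‖x‖ ^ 2 * |u τ x - ustar τ x|) ≤ C₃ * Real.sqrt (KL τ))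
    -- (v) finiteness and integrability
    (hfin1 : ∀ τ ∈ Set.Icc (0 : ℝ) t, Integrable fun x =>
      ⟪score d (u τ) x - s τ x, D τ x (score d (u τ) x - s τ x)⟫ * u τ x)
    (hfin2 : ∀ τ ∈ Set.Icc (0 : ℝ) t, Integrable fun x =>
      ⟪score d (u τ) x - score d (ustar τ) x,
        D τ x (score d (u τ) x - score d (ustar τ) x)⟫ * u τ x)
    (hfin3 : ∀ τ ∈ Set.Icc (0 : ℝ) t, Integrable fun x =>
      (∑ i, ∑ j, score d (ustar τ) x i * (Smat τ i j - Sstarmat τ i j)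
        * (score d (u τ) x j - score d (ustar τ) x j)) * u τ x)
    (hfin4 : ∀ τ ∈ Set.Icc (0 : ℝ) t, Integrable fun x =>
      ‖score d (ustar τ) x‖ ^ 2 * u τ x)
    (hℓint : IntervalIntegrable ℓ volume 0 t) :
    KL t ≤ 2 * Real.exp (Mc * t) * ∫ τ in (0 : ℝ)..t, ℓ τ := by
  have hsub : Set.Icc 0 t ⊆ Set.Icc 0 T := Set.Icc_subset_Icc_right ht.2
  have hKLnn : ∀ τ ∈ Set.Icc (0 : ℝ) t, 0 ≤ KL τ := fun τ hτ => by
    rw [hKL]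
    exact aux_gibbs _ _ (hupos τ (hsub hτ)) (hustarpos τ (hsub hτ)) (hunorm τ (hsub hτ))
      (hustarnorm τ (hsub hτ))
  have hℓnn : ∀ τ ∈ Set.Icc (0 : ℝ) t, 0 ≤ ℓ τ := fun τ hτ => by
    rw [hℓ]
    refine integral_nonneg fun x => mul_nonneg ?_ (hupos τ (hsub hτ) x).le
    exact le_trans (by positivity) (hellip τ hτ x _)
  have hM : 0 ≤ Mc := by rw [hMc]; positivity
  have hd1 : (1 : ℝ) ≤ (d : ℝ) ^ 2 := by
    have : (1 : ℝ) ≤ d := by exact_mod_cast hd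
    exact one_le_pow₀ this
  have hder : ∀ τ ∈ Set.Ioo (0 : ℝ) t, deriv KL τ ≤ 2 * ℓ τ + Mc * KL τ := by
    intro τ hτ
    have hτ' := Set.Ioo_subset_Icc_self hτ
    have hτT := hsub hτ'
    set δ := ∫ x, ‖x‖ ^ 2 * |u τ x - ustar τ x| with hδ
    have hδ0 : 0 ≤ δ := integral_nonneg fun x => by positivity
    have hδ2 : δ ^ 2 ≤ C₃ ^ 2 * KL τ := by
      calc δ ^ 2 ≤ (C₃ * Real.sqrt (KL τ)) ^ 2 := pow_le_pow_left₀ hδ0 (hCKP τ hτ') 2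
        _ = _ := by rw [mul_pow, Real.sq_sqrt (hKLnn τ hτ')]
    have i1 : Integrable fun x => ‖x‖ ^ 2 * u τ x := by
      by_contra h
      have := henergy τ hτT
      rw [integral_undef h] at this; linarith
    have i2 : Integrable fun x => ‖x‖ ^ 2 * ustar τ x := by
      by_contra h
      have := henergystar τ hτT
      rw [integral_undef h] at this; linarith
    have key : (∫ x, (∑ i, ∑ j, score d (ustar τ) x i * (Smat τ i j - Sstarmat τ i j)
            * (score d (u τ) x j - score d (ustar τ) x j)) * u τ x)
        ≤ (∫ x, (1 / 2) * (⟪score d (u τ) x - score d (ustar τ) x,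
            D τ x (score d (u τ) x - score d (ustar τ) x)⟫ * u τ x)
          + δ ^ 2 / (2 * ε) * (‖score d (ustar τ) x‖ ^ 2 * u τ x)) := by
      refine integral_mono (hfin3 τ hτ')
        (((hfin2 τ hτ').const_mul _).add ((hfin4 τ hτ').const_mul _)) fun x => ?_
      have q := aux_quad (u τ) (ustar τ) (hu τ hτT).continuous (hustar τ hτT).continuous i1 i2
        (score d (ustar τ) x) (score d (u τ) x - score d (ustar τ) x)
      simp only [← hSmat, ← hSstarmat, PiLp.sub_apply] at q
      rw [← hδ] at q
      have el := hellip τ hτ' x (score d (u τ) x - score d (ustar τ) x)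
      have up := (hupos τ hτT x).le
      set a := ‖score d (ustar τ) x‖
      set b := ‖score d (u τ) x - score d (ustar τ) x‖
      have y : a * b * δ ≤ ε * b ^ 2 / 2 + δ ^ 2 / (2 * ε) * a ^ 2 := by
        have : ε * b ^ 2 / 2 + δ ^ 2 / (2 * ε) * a ^ 2 - a * b * δ
            = (ε * b - δ * a) ^ 2 / (2 * ε) := by field_simp; ring
        have h0 : 0 ≤ (ε * b - δ * a) ^ 2 / (2 * ε) := by positivity
        linarith
      have this := mul_le_mul_of_nonneg_right ((q.trans y).trans (show _ ≤ (1 / 2) *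
        ⟪score d (u τ) x - score d (ustar τ) x,
            D τ x (score d (u τ) x - score d (ustar τ) x)⟫ + δ ^ 2 / (2 * ε) * a ^ 2 by
          linarith)) up
      refine this.trans (le_of_eq ?_)
      ring
    rw [integral_add ((hfin2 τ hτ').const_mul _) ((hfin4 τ hτ').const_mul _),
      integral_const_mul, integral_const_mul] at key
    have h3 : δ ^ 2 / (2 * ε) * (∫ x, ‖score d (ustar τ) x‖ ^ 2 * u τ x) ≤ Mc * KL τ := by
      have k0 := hKLnn τ hτ'
      have t0 := hτ.1.le
      calc _ ≤ (C₃ ^ 2 * KL τ) / (2 * ε) * (8 * C₁ * (1 + τ) * (1 + En)) := by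
            gcongr
            · exact integral_nonneg fun x => mul_nonneg (by positivity) (hupos τ hτT x).le
            · exact hscore τ hτ'
        _ = (4 * C₁ / ε) * (1 + En) * 1 * C₃ ^ 2 * (1 + τ) * KL τ := by field_simp; ring
        _ ≤ (4 * C₁ / ε) * (1 + En) * (d : ℝ) ^ 2 * C₃ ^ 2 * (1 + T) * KL τ := by
            have := hτT.2
            gcongr
        _ = _ := by rw [hMc]
    have := hKLderiv τ hτ
    linarith
  have hmain := intervalIntegral.sub_le_integral_of_hasDeriv_right_of_le
    (g := fun τ => Real.exp (-(Mc * τ)) * KL τ)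
    (g' := fun τ => Real.exp (-(Mc * τ)) * (-(Mc * 1)) * KL τ + Real.exp (-(Mc * τ)) * deriv KL τ)
    (φ := fun τ => 2 * ℓ τ) ht.1
    (ContinuousOn.mul (by fun_prop) hKLcont)
    (fun τ hτ => ((((hasDerivAt_id τ).const_mul Mc).neg.exp).mul
      (hKLdiff τ hτ).hasDerivAt).hasDerivWithinAt)
    (by
      have := (intervalIntegrable_iff_integrableOn_Icc_of_le ht.1).1 hℓint
      exact Integrable.const_mul this 2)
    (fun τ hτ => by
      have h := hder τ hτ
      have l0 := hℓnn τ (Set.Ioo_subset_Icc_self hτ)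
      have e1 : Real.exp (-(Mc * τ)) ≤ 1 := by
        rw [Real.exp_le_one_iff]
        have := mul_nonneg hM hτ.1.le
        linarith
      have e0 := Real.exp_pos (-(Mc * τ))
      calc _ = Real.exp (-(Mc * τ)) * (deriv KL τ - Mc * KL τ) := by ring
        _ ≤ Real.exp (-(Mc * τ)) * (2 * ℓ τ) := by gcongr; linarith
        _ ≤ 1 * (2 * ℓ τ) := by gcongr
        _ = _ := one_mul _)
  rw [intervalIntegral.integral_const_mul] at hmain
  simp only [hKL0, mul_zero, sub_zero] at hmain
  have e0 := Real.exp_pos (Mc * t)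
  calc KL t = Real.exp (Mc * t) * (Real.exp (-(Mc * t)) * KL t) := by
        rw [← mul_assoc, ← Real.exp_add]; simp
    _ ≤ Real.exp (Mc * t) * (2 * ∫ τ in (0 : ℝ)..t, ℓ τ) := by gcongr
    _ = _ := by ring
end
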